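/- Let φ: A* → A* be non-erasing with alph(φ^n(a)) = alph(φ(a)) for every a ∈ A and n ≥ 1, let A' be a leaf of the tree of invariant subalphabets of φ, let g ∈ A' be an unbounded letter, let G' = (A', φ|_{A'}, g), and let Ψ: A* → B* be a morphism. Then the set of primitive words v such that v^k ∈ fact(Ψ(L_{G'})) for all k ∈ ℕ is finite. -/

import Mathlib

/-- The extension of the morphism given by `φ` on letters to a morphism on words. -/
def extM {A B : Type*} (φ : A → List B) (w : List A) : List B := w.flatMap φ

/-- The `k`-th power `u^k` of a word `u`. -/
def wpow {A : Type*} (u : List A) (k : ℕ) : List A := (List.replicate k u).flatten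

/-- A word `v` is primitive if `v = u^k` implies `k = 1`. -/
def Primitive {A : Type*} (v : List A) : Prop :=
  v ≠ [] ∧ ∀ (u : List A) (k : ℕ), v = wpow u k → k = 1

/-- The language of the D0L-system `(A, φ, w)`: all factors of the words `φ^n(w)`. -/
def LangD0L {A : Type*} (φ : A → List A) (w : List A) : Set (List A) :=
  {v | ∃ n : ℕ, v <:+: (extM φ)^[n] w}

/-- `fact(Ψ(L))`: all factors of `Ψ`-images of elements of `L`. -/
def factImg {A B : Type*} (Ψ : A → List B) (L : Set (List A)) : Set (List B) :=
  {v | ∃ u ∈ L, v <:+: extM Ψ u}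

/-- The language of the HD0L-system `(A, φ, w, Ψ)`. -/
def LangHD0L {A B : Type*} (φ : A → List A) (w : List A) (Ψ : A → List B) : Set (List B) :=
  factImg Ψ (LangD0L φ w)

/-- A morphism is non-erasing if no letter is mapped to the empty word. -/
def NonErasing {A B : Type*} (φ : A → List B) : Prop := ∀ a, φ a ≠ []

/-- A letter `b` is bounded (w.r.t. `φ`) if the lengths `|φ^n(b)|` are bounded. -/
def BddLetter {A : Type*} (φ : A → List A) (b : A) : Prop :=
  ∃ C : ℕ, ∀ n : ℕ, ((extM φ)^[n] [b]).length ≤ C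

/-- The set of letters occurring in a word. -/
def alph {A : Type*} (u : List A) : Set A := {a | a ∈ u}

/-- `alph(φ(S))` for a set of letters `S`: letters occurring in `φ(b)` for some `b ∈ S`. -/
def alphIm {A : Type*} (φ : A → List A) (S : Set A) : Set A := ⋃ b ∈ S, alph (φ b)

/-- A D0L-system is pushy if its language contains infinitely many words over bounded letters. -/
def Pushy {A : Type*} (φ : A → List A) (w : List A) : Prop :=
  {v ∈ LangD0L φ w | ∀ a ∈ v, BddLetter φ a}.Infinite

/-- A factorial language `L` is uniformly recurrent: for every `n` there is `K` such that
every element of `L` of length `K` contains every element of `L` of length `n` as a factor. -/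
def UnifRec {A : Type*} (L : Set (List A)) : Prop :=
  ∀ n : ℕ, ∃ K : ℕ, ∀ u ∈ L, u.length = K → ∀ v ∈ L, v.length = n → v <:+: u

/-- Vertices of the tree of invariant subalphabets of `φ`: nonempty sets `S` with
`alph(φ(S)) = S` containing an unbounded letter `a` with `alph(φ(a)) = S`. -/
def IsVertex {A : Type*} (φ : A → List A) (S : Set A) : Prop :=
  S.Nonempty ∧ alphIm φ S = S ∧ ∃ a ∈ S, ¬ BddLetter φ a ∧ alph (φ a) = S

/-- Leaves of the tree of invariant subalphabets: minimal vertices w.r.t. inclusion. -/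
def IsLeaf {A : Type*} (φ : A → List A) (S : Set A) : Prop :=
  IsVertex φ S ∧ ∀ T, IsVertex φ T → T ⊆ S → T = S

/-- Two words are conjugate: `u = xy` and `v = yx`. -/
def Conj {A : Type*} (u v : List A) : Prop := ∃ x y : List A, u = x ++ y ∧ v = y ++ x

/-- The prefix of length `n` of an infinite word. -/
def prefW {A : Type*} (w : ℕ → A) (n : ℕ) : List A := (List.range n).map w

section Helpers

theorem extM_append' {A B : Type*} (f : A → List B) (x y : List A) :
    extM f (x ++ y) = extM f x ++ extM f y := by simp [extM]

theorem it_append {A : Type*} (φ : A → List A) (n : ℕ) (x y : List A) :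
    (extM φ)^[n] (x ++ y) = (extM φ)^[n] x ++ (extM φ)^[n] y := by
  induction n generalizing x y with
  | zero => rfl
  | succ n ih => rw [Function.iterate_succ_apply, Function.iterate_succ_apply,
      Function.iterate_succ_apply, extM_append', ih]

theorem it_nil {A : Type*} (φ : A → List A) (n : ℕ) : (extM φ)^[n] [] = [] := by
  induction n with
  | zero => rfl
  | succ n ih => rw [Function.iterate_succ_apply]; simpa [extM] using ih

theorem it_flatMap {A : Type*} (φ : A → List A) (n : ℕ) (x : List A) :
    (extM φ)^[n] x = x.flatMap (fun a => (extM φ)^[n] [a]) := by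
  induction x with
  | nil => simp [it_nil]
  | cons a x ih => rw [← List.singleton_append, it_append, ih]; simp

theorem it_one {A : Type*} (φ : A → List A) (n : ℕ) (a : A) :
    (extM φ)^[n+1] [a] = (extM φ)^[n] (φ a) := by
  rw [Function.iterate_succ_apply]; simp [extM]

theorem len_flatMap_le {A B : Type*} (f : A → List B) (C : ℕ) (x : List A)
    (h : ∀ a ∈ x, (f a).length ≤ C) : (x.flatMap f).length ≤ x.length * C := by
  induction x with
  | nil => simp
  | cons a x ih =>
    have h1 := h a (by simp)
    have h2 := ih (fun b hb => h b (by simp [hb]))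
    simp only [List.flatMap_cons, List.length_append, List.length_cons]
    nlinarith

theorem infix_flatMap {A B : Type*} (f : A → List B) {x y : List A} (h : x <:+: y) :
    x.flatMap f <:+: y.flatMap f := by
  obtain ⟨s, t, rfl⟩ := h
  exact ⟨s.flatMap f, t.flatMap f, by simp⟩

theorem mem_infix {A : Type*} {a : A} {x : List A} (h : a ∈ x) : [a] <:+: x := by
  obtain ⟨s, t, rfl⟩ := List.append_of_mem h
  exact ⟨s, t, by simp⟩

theorem it_infix {A : Type*} (φ : A → List A) (n : ℕ) {x y : List A} (h : x <:+: y) :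
    (extM φ)^[n] x <:+: (extM φ)^[n] y := by
  rw [it_flatMap, it_flatMap φ n y]; exact infix_flatMap _ h

theorem wpow_zero' {A : Type*} (u : List A) : wpow u 0 = [] := by simp [wpow]

theorem wpow_succ' {A : Type*} (u : List A) (k : ℕ) : wpow u (k+1) = u ++ wpow u k := by
  simp [wpow, List.replicate_succ]

theorem wpow_add' {A : Type*} (u : List A) (k l : ℕ) :
    wpow u (k+l) = wpow u k ++ wpow u l := by
  rw [wpow, List.replicate_add, List.flatten_append]; rfl

theorem wpow_length {A : Type*} (u : List A) (k : ℕ) : (wpow u k).length = k * u.length := by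
  simp [wpow]

theorem wpow_get {A : Type*} (u : List A) (k i : ℕ) (h : i < k * u.length) :
    (wpow u k)[i]? = u[i % u.length]? := by
  induction k generalizing i with
  | zero => simp at h
  | succ k ih =>
    rw [wpow_succ', List.getElem?_append]
    split_ifs with hi
    · rw [Nat.mod_eq_of_lt hi]
    · push Not at hi
      rw [ih (i - u.length) (by rw [Nat.succ_mul] at h; omega), ← Nat.mod_eq_sub_mod hi]

theorem wpow_reverse {A : Type*} (u : List A) (k : ℕ) :
    (wpow u k).reverse = wpow u.reverse k := by
  induction k with
  | zero => simp [wpow]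
  | succ k ih =>
    rw [wpow_succ', List.reverse_append, ih, wpow_add']; simp [wpow]

theorem extM_wpow {A B : Type*} (f : A → List B) (u : List A) (k : ℕ) :
    extM f (wpow u k) = wpow (extM f u) k := by
  induction k with
  | zero => simp [wpow, extM]
  | succ k ih => rw [wpow_succ', extM_append', ih, wpow_succ']

theorem split_pow {A : Type*} {v x y : List A} {a b : ℕ} (h : wpow v (a+b) <:+: x ++ y) :
    wpow v a <:+: x ∨ wpow v b <:+: y := by
  obtain ⟨p, s, h⟩ := h
  rw [wpow_add'] at h
  have h' : (p ++ wpow v a) ++ (wpow v b ++ s) = x ++ y := by rw [← h]; simp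
  rcases List.append_eq_append_iff.1 h' with ⟨c, hx, hy⟩ | ⟨c, hx, hy⟩
  · left; exact ⟨p, c, by rw [hx]⟩
  · right; exact ⟨c, s, by rw [hy]; simp⟩

theorem pow_not_short {A : Type*} {v x : List A} {K : ℕ} (hv : v ≠ []) (hx : x.length < K) :
    ¬ wpow v K <:+: x := by
  intro h
  have h1 := h.length_le
  rw [wpow_length] at h1
  have : 0 < v.length := List.length_pos_iff.2 hv
  nlinarith

/-- Fine and Wilf in the form needed here. -/
theorem fine_wilf {A : Type*} {v w : List A} {k m : ℕ} (hv : Primitive v)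
    (hk : w.length + 1 ≤ k) (h : wpow v k <:+: wpow w m) : v.length ≤ w.length := by
  have hp : 0 < v.length := List.length_pos_iff.2 hv.1
  have hw : 0 < w.length := by
    by_contra h0
    have h1 := h.length_le
    rw [wpow_length, wpow_length] at h1
    have : w.length = 0 := by omega
    rw [this] at h1
    nlinarith
  set p := v.length with hpdef
  set q := w.length with hqdef
  obtain ⟨s, t, hst⟩ := h
  -- reading letters
  have key : ∀ i, i < k * p → v[i % p]? = w[(s.length + i) % q]? := by
    intro i hi
    rw [← wpow_get v k i hi, ← wpow_get w m (s.length + i), ← hst]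
    · rw [List.append_assoc, List.getElem?_append_right (by omega),
        List.getElem?_append_left (by rw [wpow_length]; simpa using hi)]
      congr 1; omega
    · have := congrArg List.length hst
      simp only [List.length_append, wpow_length] at this
      rw [← this]; simp only [← hpdef]; omega
  have perq : ∀ i, v[(i + q) % p]? = v[i % p]? := by
    intro i
    have hlt : i % p < p := Nat.mod_lt _ hp
    have hkp : p + q ≤ k * p := by nlinarith
    have e1 : (i + q) % p = (i % p + q) % p := by simp
    have h1 := key (i % p + q) (by omega)
    have h2 := key (i % p) (by omega)
    rw [e1, h1, ← Nat.add_assoc, Nat.add_mod_right, ← h2, Nat.mod_mod]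
  have perq' : ∀ a i, v[(i + a * q) % p]? = v[i % p]? := by
    intro a
    induction a with
    | zero => simp
    | succ a ih => intro i; rw [Nat.succ_mul, ← Nat.add_assoc, perq, ih]
  by_contra hlt
  push Not at hlt
  have hdq : Nat.gcd q p ≤ q := Nat.gcd_le_left _ hw
  obtain ⟨a, -, ha⟩ := Nat.exists_mul_mod_eq_gcd (n := q) (k := p) (by omega)
  set d := Nat.gcd q p with hd
  have hdpos : 0 < d := Nat.gcd_pos_of_pos_left _ hw
  have perd : ∀ i, v[(i + d) % p]? = v[i % p]? := by
    intro i
    rw [← perq' a i, ← ha, Nat.add_mod_mod, Nat.mul_comm]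
  have perd' : ∀ a i, v[(i + a * d) % p]? = v[i % p]? := by
    intro a
    induction a with
    | zero => simp
    | succ a ih => intro i; rw [Nat.succ_mul, ← Nat.add_assoc, perd, ih]
  obtain ⟨e, he⟩ : d ∣ p := Nat.gcd_dvd_right _ _
  have hlen : (v.take d).length = d := by rw [List.length_take]; omega
  have hve : v = wpow (v.take d) e := by
    apply List.ext_getElem?
    intro i
    by_cases hi : i < p
    · have hid : i % d < d := Nat.mod_lt _ hdpos
      rw [wpow_get _ _ _ (by rw [hlen, Nat.mul_comm, ← he]; exact hi), hlen,
        List.getElem?_take_of_lt hid]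
      have h1 := perd' (i / d) (i % d)
      rw [Nat.mod_add_div', Nat.mod_eq_of_lt hi, Nat.mod_eq_of_lt (by omega)] at h1
      exact h1
    · rw [List.getElem?_eq_none (by omega), List.getElem?_eq_none]
      rw [wpow_length, hlen, Nat.mul_comm, ← he]; omega
  have := hv.2 _ _ hve
  subst this
  omega

end Helpers

section Helpers2

theorem pref_flatMap {A B : Type*} (f : A → List B) (bad : A → Prop) (y : List A) (W : List B)
    (hW : ∀ a ∈ y, bad a → ¬ f a <:+: W) (h : W <+: y.flatMap f) :
    ∃ z e : List A, e.length ≤ 1 ∧ (∀ a ∈ z, ¬ bad a) ∧ z ++ e <+: y ∧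
      ∃ c, c <+: e.flatMap f ∧ W = z.flatMap f ++ c := by
  induction y generalizing W with
  | nil =>
    refine ⟨[], [], by simp, by simp, by simp, W, by simpa using h, by simp⟩
  | cons a y ih =>
    obtain ⟨t, ht⟩ := h
    rw [List.flatMap_cons] at ht
    rcases List.append_eq_append_iff.1 ht with ⟨c, hx, hy⟩ | ⟨c, hx, hy⟩
    · exact ⟨[], [a], by simp, by simp, by simp, W, ⟨c, by simpa using hx.symm⟩, by simp⟩
    · have hna : ¬ bad a := fun hb => hW a (by simp) hb ⟨[], c, by simp [hx]⟩
      obtain ⟨z, e, he, hz, hp, c', hc', hWc⟩ := ih c (fun b hb hbad hin =>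
        hW b (by simp [hb]) hbad (hin.trans ⟨f a, [], by simp [hx]⟩)) ⟨t, hy.symm⟩
      refine ⟨a :: z, e, he, ?_, ?_, c', hc', ?_⟩
      · intro b hb
        rcases List.mem_cons.1 hb with rfl | hb
        · exact hna
        · exact hz b hb
      · simpa using hp
      · rw [hx, hWc]; simp

theorem inf_flatMap {A B : Type*} (f : A → List B) (bad : A → Prop) (y : List A) (W : List B)
    (hW : ∀ a ∈ y, bad a → ¬ f a <:+: W) (h : W <:+: y.flatMap f) :
    (∃ a ∈ y, W <:+: f a) ∨ W = [] ∨
    ∃ d z e : List A, d.length ≤ 1 ∧ e.length ≤ 1 ∧ (∀ a ∈ z, ¬ bad a) ∧ d ++ z ++ e <:+: y ∧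
      ∃ c c', c <:+ d.flatMap f ∧ c' <+: e.flatMap f ∧ W = c ++ z.flatMap f ++ c' := by
  induction y with
  | nil => right; left; simpa using h
  | cons a y ih =>
    obtain ⟨p, s, h⟩ := h
    rw [List.flatMap_cons, List.append_assoc] at h
    rcases List.append_eq_append_iff.1 h with ⟨c, hx, hy⟩ | ⟨c, hx, hy⟩
    · rcases List.append_eq_append_iff.1 hy with ⟨c', hx', hy'⟩ | ⟨c', hx', hy'⟩
      · left; exact ⟨a, by simp, p, c', by rw [hx, hx']; simp⟩
      · right; right
        obtain ⟨z, e, he, hz, hp, c'', hc', hWc⟩ := pref_flatMap f bad y c' (fun b hb hbad hin =>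
          hW b (by simp [hb]) hbad (hin.trans ⟨c, [], by simp [hx']⟩)) ⟨s, hy'.symm⟩
        refine ⟨[a], z, e, by simp, he, hz, ?_, c, c'', ⟨p, by simp [hx]⟩, hc', ?_⟩
        · obtain ⟨t, ht⟩ := hp
          exact ⟨[], t, by simp [← ht]⟩
        · rw [hx', hWc]; simp
    · rcases ih (fun b hb => hW b (by simp [hb])) ⟨c, s, by rw [hy]; simp⟩ with
        ⟨b, hb, hin⟩ | h0 | ⟨d, z, e, hd, he, hz, hin, rest⟩
      · left; exact ⟨b, by simp [hb], hin⟩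
      · right; left; exact h0
      · right; right
        exact ⟨d, z, e, hd, he, hz, hin.trans ⟨[a], [], by simp⟩, rest⟩

theorem bdd_const {A : Type*} [Fintype A] (φ : A → List A) :
    ∃ C : ℕ, ∀ b, BddLetter φ b → ∀ n, ((extM φ)^[n] [b]).length ≤ C := by
  classical
  have h : ∀ b, ∃ C : ℕ, BddLetter φ b → ∀ n, ((extM φ)^[n] [b]).length ≤ C := by
    intro b
    by_cases hb : BddLetter φ b
    · obtain ⟨C, hC⟩ := hb; exact ⟨C, fun _ => hC⟩
    · exact ⟨0, fun h => absurd h hb⟩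
  choose C hC using h
  exact ⟨Finset.univ.sup C, fun b hb n => (hC b hb n).trans (Finset.le_sup (Finset.mem_univ b))⟩

theorem bdd_of_mem {A : Type*} (φ : A → List A) {b c : A} {n : ℕ} (hb : BddLetter φ b)
    (hc : c ∈ (extM φ)^[n] [b]) : BddLetter φ c := by
  obtain ⟨C, hC⟩ := hb
  refine ⟨C, fun m => le_trans ?_ (hC (m + n))⟩
  rw [Function.iterate_add_apply]
  exact (it_infix φ m (mem_infix hc)).length_le

theorem bdd_it {A : Type*} (φ : A → List A) {z : List A} (hz : ∀ a ∈ z, BddLetter φ a) (n : ℕ) :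
    ∀ a ∈ (extM φ)^[n] z, BddLetter φ a := by
  intro a ha
  rw [it_flatMap, List.mem_flatMap] at ha
  obtain ⟨b, hb, hab⟩ := ha
  exact bdd_of_mem φ (hz b hb) hab

/-- the image of an unbounded letter contains an unbounded letter -/
theorem unb_succ {A : Type*} [Fintype A] (φ : A → List A) {c : A} (hc : ¬ BddLetter φ c) :
    ∃ d ∈ φ c, ¬ BddLetter φ d := by
  by_contra h
  push Not at h
  apply hc
  obtain ⟨C, hC⟩ := bdd_const φ
  refine ⟨1 + (φ c).length * C, fun n => ?_⟩
  cases n with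
  | zero => simp
  | succ n =>
    rw [it_one, it_flatMap]
    have := len_flatMap_le (fun a => (extM φ)^[n] [a]) C (φ c) (fun a ha => hC a (h a ha) n)
    omega

theorem unb_it {A : Type*} [Fintype A] (φ : A → List A) (n : ℕ) {c : A}
    (hc : ¬ BddLetter φ c) : ∃ d ∈ (extM φ)^[n] [c], ¬ BddLetter φ d := by
  induction n generalizing c with
  | zero => exact ⟨c, by simp, hc⟩
  | succ n ih =>
    obtain ⟨d, hd, hdu⟩ := unb_succ φ hc
    obtain ⟨e, he, heu⟩ := ih hdu
    refine ⟨e, ?_, heu⟩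
    rw [it_one]
    exact (it_infix φ n (mem_infix hd)).subset he

theorem first_bad {A : Type*} (bad : A → Prop) (u : List A) (h : ∃ d ∈ u, bad d) :
    ∃ X d Y, u = X ++ d :: Y ∧ (∀ a ∈ X, ¬ bad a) ∧ bad d := by
  induction u with
  | nil => simp at h
  | cons a u ih =>
    by_cases ha : bad a
    · exact ⟨[], a, u, by simp, by simp, ha⟩
    · obtain ⟨X, d, Y, h1, h2, h3⟩ := ih (by
        obtain ⟨d, hd, hb⟩ := h
        rcases List.mem_cons.1 hd with rfl | hd
        · exact absurd hb ha
        · exact ⟨d, hd, hb⟩)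
      refine ⟨a :: X, d, Y, by simp [h1], ?_, h3⟩
      intro b hb
      rcases List.mem_cons.1 hb with rfl | hb
      · exact ha
      · exact h2 b hb

/-- accumulated bounded prefix of the iterates -/
def preW {A : Type*} (φ : A → List A) (X : A → List A) (st : A → A) : ℕ → A → List A
  | 0, _ => []
  | n+1, c => (extM φ)^[n] (X c) ++ preW φ X st n (st c)

theorem preW_add {A : Type*} (φ : A → List A) (X : A → List A) (st : A → A) (n m : ℕ) (c : A) :
    preW φ X st (n + m) c = (extM φ)^[n] (preW φ X st m c) ++ preW φ X st n (st^[m] c) := by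
  induction m generalizing c with
  | zero => simp [preW, it_nil]
  | succ m ih =>
    rw [← Nat.add_assoc, preW, ih, preW, it_append, Function.iterate_add_apply,
      Function.iterate_succ_apply, List.append_assoc]

/-- Bounded prefixes of iterates on a letter are almost periodic. -/
theorem one_sided {A : Type*} [Fintype A] (φ : A → List A) :
    ∃ M : ℕ, ∀ (c : A) (n : ℕ) (x : List A), x <+: (extM φ)^[n] [c] → (∀ a ∈ x, BddLetter φ a) →
      ∃ (s w : List A) (m : ℕ) (s' : List A), s.length ≤ M ∧ w.length ≤ M ∧ s'.length ≤ M ∧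
        x <:+: s ++ (wpow w m ++ s') := by
  classical
  obtain ⟨C, hC⟩ := bdd_const φ
  have hex : ∀ c, ∃ (X : List A) (d : A), ¬ BddLetter φ c →
      ((∃ Y, φ c = X ++ d :: Y) ∧ (∀ a ∈ X, BddLetter φ a) ∧ ¬ BddLetter φ d) := by
    intro c
    by_cases hc : BddLetter φ c
    · exact ⟨[], c, fun h => absurd hc h⟩
    · obtain ⟨X, d, Y, h1, h2, h3⟩ := first_bad (fun a => ¬ BddLetter φ a) _ (unb_succ φ hc)
      exact ⟨X, d, fun _ => ⟨⟨Y, h1⟩, fun a ha => not_not.1 (h2 a ha), h3⟩⟩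
  choose X st hX using hex
  -- shape of the iterates
  have F1 : ∀ n c, ¬ BddLetter φ c → (∀ a ∈ preW φ X st n c, BddLetter φ a) ∧
      ¬ BddLetter φ (st^[n] c) ∧ ∃ Y, (extM φ)^[n] [c] = preW φ X st n c ++ st^[n] c :: Y := by
    intro n
    induction n with
    | zero => intro c hc; exact ⟨by simp [preW], hc, [], by simp [preW]⟩
    | succ n ih =>
      intro c hc
      obtain ⟨⟨Y, hY⟩, hXb, hst⟩ := hX c hc
      obtain ⟨i1, i2, Y', hY'⟩ := ih (st c) hst
      refine ⟨?_, i2, ?_⟩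
      · intro a ha
        rw [preW, List.mem_append] at ha
        rcases ha with ha | ha
        · exact bdd_it φ hXb n a ha
        · exact i1 a ha
      · refine ⟨Y' ++ (extM φ)^[n] Y, ?_⟩
        rw [it_one, hY, it_append, ← List.singleton_append, it_append, hY', preW,
          Function.iterate_succ_apply]
        simp
  -- pigeonhole
  obtain ⟨i, q, hq, hst, hphi⟩ : ∃ i q : ℕ, 0 < q ∧ st^[i+q] = st^[i] ∧
      ∀ b, BddLetter φ b → (extM φ)^[i+q] [b] = (extM φ)^[i] [b] := by
    let F : ℕ → (A → A) × (A → List A) := fun n =>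
      (st^[n], fun b => if BddLetter φ b then (extM φ)^[n] [b] else [])
    have hfin : (Set.univ ×ˢ (Set.univ.pi (fun _ : A => {l : List A | l.length ≤ C})) :
        Set ((A → A) × (A → List A))).Finite :=
      Set.Finite.prod Set.finite_univ (Set.Finite.pi' (fun _ => List.finite_length_le A C) |>.subset
        (fun f hf a => hf a (Set.mem_univ _)))
    have hmaps : Set.MapsTo F Set.univ (Set.univ ×ˢ (Set.univ.pi
        (fun _ : A => {l : List A | l.length ≤ C}))) := by
      intro n _
      refine ⟨Set.mem_univ _, fun b _ => ?_⟩
      show (if BddLetter φ b then (extM φ)^[n] [b] else []).length ≤ C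
      split_ifs with hb
      · exact hC b hb n
      · simp
    obtain ⟨a, -, b, -, hab, he⟩ :=
      Set.infinite_univ.exists_lt_map_eq_of_mapsTo hmaps hfin
    refine ⟨a, b - a, by omega, ?_, ?_⟩
    · rw [Nat.add_sub_cancel' hab.le]; exact (congrArg Prod.fst he).symm
    · intro c hc
      have := congrFun (congrArg Prod.snd he) c
      simp only [F, hc, if_true] at this
      rw [Nat.add_sub_cancel' hab.le, this]
  have hphi2 : ∀ z : List A, (∀ a ∈ z, BddLetter φ a) → ∀ r t,
      (extM φ)^[i + r + q * t] z = (extM φ)^[i + r] z := by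
    intro z hz r t
    induction t with
    | zero => simp
    | succ t ih =>
      rw [← ih, show i + r + q * (t+1) = (r + q * t) + (i + q) by ring,
        show i + r + q * t = (r + q * t) + i by ring, Function.iterate_add_apply,
        Function.iterate_add_apply _ _ i]
      congr 1
      rw [it_flatMap, it_flatMap φ i z]
      exact List.flatMap_congr (fun a ha => hphi a (hz a ha))
  obtain ⟨D, hD⟩ : ∃ D : ℕ, ∀ N < 2 * i + 2 * q + 1, ∀ c, ((extM φ)^[N] [c]).length ≤ D := by
    refine ⟨(Finset.range (2 * i + 2 * q + 1)).sup
      (fun N => Finset.univ.sup (fun c => ((extM φ)^[N] [c]).length)), fun N hN c => ?_⟩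
    refine le_trans ?_ (Finset.le_sup (Finset.mem_range.2 hN))
    exact Finset.le_sup (f := fun c => ((extM φ)^[N] [c]).length) (Finset.mem_univ c)
  have hpreD : ∀ N < 2 * i + 2 * q + 1, ∀ c, ¬ BddLetter φ c → (preW φ X st N c).length ≤ D := by
    intro N hN c hc
    obtain ⟨-, -, Y, hY⟩ := F1 N c hc
    have := hD N hN c
    rw [hY, List.length_append] at this
    omega
  have hbl : ∀ n, ∀ z : List A, (∀ a ∈ z, BddLetter φ a) → z.length ≤ D →
      ((extM φ)^[n] z).length ≤ D * C := by
    intro n z hz hzD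
    rw [it_flatMap]
    exact (len_flatMap_le _ C z (fun a ha => hC a (hz a ha) n)).trans
      (Nat.mul_le_mul_right _ hzD)
  have short : ∀ x : List A, x.length ≤ C + D + D * C → 
      ∃ (s w : List A) (m : ℕ) (s' : List A), s.length ≤ C + D + D * C ∧
        w.length ≤ C + D + D * C ∧ s'.length ≤ C + D + D * C ∧
        x <:+: s ++ (wpow w m ++ s') := fun x hx =>
    ⟨x, [], 0, [], hx, by simp, by simp, by simp [wpow]⟩
  refine ⟨C + D + D * C, fun c N x hx hxb => ?_⟩
  by_cases hc : BddLetter φ c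
  · apply short
    have := hx.length_le
    have := hC c hc N
    omega
  by_cases hN : N < 2 * i + 2 * q + 1
  · apply short
    have := hx.length_le
    have := hD N hN c
    omega
  -- main case
  have hxpre : x <+: preW φ X st N c := by
    obtain ⟨-, hu, Y, hY⟩ := F1 N c hc
    rw [hY] at hx
    obtain ⟨t, ht⟩ := hx
    rcases List.append_eq_append_iff.1 ht with ⟨e, h1, h2⟩ | ⟨e, h1, h2⟩
    · exact ⟨e, h1.symm⟩
    · cases e with
      | nil => simp [h1]
      | cons b e =>
        simp only [List.cons_append, List.cons.injEq] at h2
        exact absurd (hxb b (by simp [h1])) (h2.1 ▸ hu)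
  obtain ⟨n, rfl⟩ : ∃ n, N = n + i := ⟨N - i, by omega⟩
  obtain ⟨r, t, hr, rfl⟩ : ∃ r t, r < q ∧ n = i + r + q * t := by
    refine ⟨(n - i) % q, (n - i) / q, Nat.mod_lt _ hq, ?_⟩
    rw [Nat.add_assoc, Nat.mod_add_div]; omega
  set c' := st^[i] c with hc'
  have hc'u : ¬ BddLetter φ c' := (F1 i c hc).2.1
  have hfix : st^[q] c' = c' := by
    rw [hc', ← Function.iterate_add_apply, Nat.add_comm, hst]
  have hXq := (F1 q c' hc'u).1
  have hform : ∀ t, preW φ X st (i + r + q * t) c' =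
      wpow ((extM φ)^[i + r] (preW φ X st q c')) t ++ preW φ X st (i + r) c' := by
    intro t
    induction t with
    | zero => simp [wpow]
    | succ t ih =>
      rw [Nat.mul_succ, ← Nat.add_assoc, preW_add, hfix, ih, hphi2 _ hXq, wpow_succ',
        List.append_assoc]
  rw [preW_add, hform] at hxpre
  refine ⟨_, _, _, _, ?_, ?_, ?_, hxpre.isInfix⟩
  · have := hbl (i + r + q * t) _ (F1 i c hc).1 (hpreD i (by omega) c hc)
    omega
  · have := hbl (i + r) _ hXq (hpreD q (by omega) c' hc'u)
    omega
  · have := hpreD (i + r) (by omega) c' hc'u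
    omega

end Helpers2

section Helpers3

/-- factors of words of the form: short, power of a short word, short -/
def AlmPer {A : Type*} (M : ℕ) (x : List A) : Prop :=
  ∃ (s w : List A) (m : ℕ) (s' : List A), s.length ≤ M ∧ w.length ≤ M ∧ s'.length ≤ M ∧
    x <:+: s ++ (wpow w m ++ s')

theorem AlmPer.mono {A : Type*} {M N : ℕ} (h : M ≤ N) {x : List A} (hx : AlmPer M x) :
    AlmPer N x := by
  obtain ⟨s, w, m, s', h1, h2, h3, h4⟩ := hx
  exact ⟨s, w, m, s', h1.trans h, h2.trans h, h3.trans h, h4⟩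

theorem AlmPer.short {A : Type*} {M : ℕ} {x : List A} (h : x.length ≤ M) : AlmPer M x :=
  ⟨x, [], 0, [], h, by simp, by simp, by simp [wpow]⟩

theorem it_rev {A : Type*} (φ : A → List A) (n : ℕ) (w : List A) :
    (extM (fun a => (φ a).reverse))^[n] w.reverse = ((extM φ)^[n] w).reverse := by
  induction n generalizing w with
  | zero => rfl
  | succ n ih =>
    rw [Function.iterate_succ_apply, Function.iterate_succ_apply, ← ih]
    congr 1
    induction w with
    | nil => simp [extM]
    | cons a w ihw => simp only [extM] at ihw ⊢; simp [ihw]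

theorem it_rev_one {A : Type*} (φ : A → List A) (n : ℕ) (a : A) :
    (extM (fun a => (φ a).reverse))^[n] [a] = ((extM φ)^[n] [a]).reverse := by
  rw [← it_rev]; rfl

theorem bdd_rev {A : Type*} (φ : A → List A) (b : A) :
    BddLetter (fun a => (φ a).reverse) b ↔ BddLetter φ b := by
  simp only [BddLetter, it_rev_one, List.length_reverse]

theorem one_sided_suff {A : Type*} [Fintype A] (φ : A → List A) :
    ∃ M : ℕ, ∀ (c : A) (n : ℕ) (x : List A), x <:+ (extM φ)^[n] [c] →
      (∀ a ∈ x, BddLetter φ a) → AlmPer M x := by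
  obtain ⟨M, hM⟩ := one_sided (fun a => (φ a).reverse)
  refine ⟨M, fun c n x hx hxb => ?_⟩
  obtain ⟨s, w, m, s', h1, h2, h3, h4⟩ := hM c n x.reverse
    (by rw [it_rev_one]; exact List.reverse_prefix.2 hx)
    (fun a ha => (bdd_rev φ a).2 (hxb a (List.mem_reverse.1 ha)))
  refine ⟨s'.reverse, w.reverse, m, s.reverse, by simpa, by simpa, by simpa, ?_⟩
  have h5 := List.reverse_infix.2 h4
  simpa [wpow_reverse] using h5

theorem bdd_struct {A : Type*} [Fintype A] (φ : A → List A) :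
    ∃ M : ℕ, ∀ (n : ℕ) (c : A) (u : List A), u <:+: (extM φ)^[n] [c] →
      (∀ a ∈ u, BddLetter φ a) →
      ∃ x y z, u = x ++ (y ++ z) ∧ y.length ≤ M ∧ AlmPer M x ∧ AlmPer M z := by
  obtain ⟨M1, hM1⟩ := one_sided φ
  obtain ⟨M2, hM2⟩ := one_sided_suff φ
  obtain ⟨C, hC⟩ := bdd_const φ
  obtain ⟨D, hD⟩ : ∃ D : ℕ, ∀ c, (φ c).length ≤ D :=
    ⟨Finset.univ.sup (fun c => (φ c).length), fun c =>
      Finset.le_sup (f := fun c => (φ c).length) (Finset.mem_univ c)⟩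
  refine ⟨1 + M1 + M2 + D * C, fun n => ?_⟩
  induction n with
  | zero =>
    intro c u hu _
    refine ⟨[], u, [], by simp, ?_, AlmPer.short (by simp), AlmPer.short (by simp)⟩
    have := hu.length_le
    simp at this
    omega
  | succ n ih =>
    intro c u hu hub
    rw [it_one, it_flatMap] at hu
    rcases inf_flatMap (fun a => (extM φ)^[n] [a]) (fun a => ¬ BddLetter φ a) (φ c) u
      (by
        intro a _ hbad hin
        obtain ⟨d, hd, hdu⟩ := unb_it φ n hbad
        exact hdu (hub d (hin.subset hd))) hu with
      ⟨a, _, hin⟩ | h0 | ⟨d, z, e, hd, he, hz, hin, x, x', hx, hx', heq⟩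
    · exact ih a u hin hub
    · exact ⟨[], [], [], by simp [h0], by simp, AlmPer.short (by simp), AlmPer.short (by simp)⟩
    · refine ⟨x, z.flatMap (fun a => (extM φ)^[n] [a]), x', by rw [heq, List.append_assoc],
        ?_, ?_, ?_⟩
      · have h1 := len_flatMap_le (fun a => (extM φ)^[n] [a]) C z
          (fun a ha => hC a (not_not.1 (hz a ha)) n)
        have h2 := hin.length_le
        have h3 := hD c
        simp only [List.length_append] at h2
        have h4 : z.length * C ≤ D * C := Nat.mul_le_mul_right _ (by omega)
        omega
      · have hxb : ∀ a ∈ x, BddLetter φ a := fun a ha => hub a (by rw [heq]; simp [ha])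
        rcases d with _ | ⟨a, _ | ⟨b, d⟩⟩
        · have : x = [] := by simpa using hx
          exact this ▸ AlmPer.short (by simp)
        · exact (hM2 a n x (by simpa using hx) hxb).mono (by omega)
        · simp at hd
      · have hxb : ∀ a ∈ x', BddLetter φ a := fun a ha => hub a (by rw [heq]; simp [ha])
        rcases e with _ | ⟨a, _ | ⟨b, e⟩⟩
        · have : x' = [] := by simpa using hx'
          exact this ▸ AlmPer.short (by simp)
        · have : AlmPer M1 x' := hM1 a n x' (by simpa using hx') hxb
          exact this.mono (by omega)
        · simp at he

/-- powers inside images of almost periodic words -/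
theorem pow_almPer {A B : Type*} (Ψ : A → List B) {E M K k : ℕ} (hE : ∀ a, (Ψ a).length ≤ E)
    {v : List B} (hv : v ≠ []) (hK : M * E < K) {x : List A} (hx : AlmPer M x)
    (h : wpow v (K + (k + K)) <:+: extM Ψ x) :
    ∃ w : List B, w.length ≤ M * E ∧ ∃ m, wpow v k <:+: wpow w m := by
  obtain ⟨s, w, m, s', h1, h2, h3, h4⟩ := hx
  have hl : ∀ y : List A, y.length ≤ M → (extM Ψ y).length ≤ M * E := fun y hy =>
    (len_flatMap_le Ψ E y (fun a _ => hE a)).trans (Nat.mul_le_mul_right _ hy)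
  have h5 := h.trans (infix_flatMap Ψ h4)
  change _ <:+: extM Ψ _ at h5
  rw [extM_append', extM_append', extM_wpow] at h5
  rcases split_pow h5 with h6 | h6
  · exact absurd h6 (pow_not_short hv (by have := hl s h1; omega))
  · rcases split_pow h6 with h7 | h7
    · exact ⟨_, hl w h2, m, h7⟩
    · exact absurd h7 (pow_not_short hv (by have := hl s' h3; omega))

/-- powers in images of bounded words have short roots -/
theorem bdd_roots {A B : Type*} [Fintype A] (φ : A → List A) (Ψ : A → List B) (g : A) :
    ∃ N : ℕ, ∀ v : List B, Primitive v →
      (∀ k, ∃ u n, u <:+: (extM φ)^[n] [g] ∧ (∀ a ∈ u, BddLetter φ a) ∧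
        wpow v k <:+: extM Ψ u) → v.length ≤ N := by
  obtain ⟨M, hM⟩ := bdd_struct φ
  obtain ⟨E, hE⟩ : ∃ D : ℕ, ∀ c, (Ψ c).length ≤ D :=
    ⟨Finset.univ.sup (fun c => (Ψ c).length), fun c =>
      Finset.le_sup (f := fun c => (Ψ c).length) (Finset.mem_univ c)⟩
  refine ⟨M * E, fun v hv h => ?_⟩
  let K := M * E + 1
  obtain ⟨u, n, hu, hub, hpow⟩ := h ((K + (K + K)) + (K + (K + (K + K))))
  obtain ⟨x, y, z, rfl, hy, hx, hz⟩ := hM n g u hu hub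
  rw [extM_append', extM_append'] at hpow
  have fin : (∃ w : List B, w.length ≤ M * E ∧ ∃ m, wpow v K <:+: wpow w m) →
      v.length ≤ M * E := by
    rintro ⟨w, hw, m, hin⟩
    exact (fine_wilf hv (by omega) hin).trans hw
  rcases split_pow hpow with h1 | h1
  · exact fin (pow_almPer Ψ hE hv.1 (by omega) hx h1)
  · rcases split_pow h1 with h2 | h2
    · refine absurd h2 (pow_not_short hv.1 ?_)
      have := (len_flatMap_le Ψ E y (fun a _ => hE a)).trans (Nat.mul_le_mul_right _ hy)
      exact Nat.lt_succ_of_le this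
    · exact fin (pow_almPer Ψ hE hv.1 (by omega) hz h2)

/-- in a leaf, the image of every unbounded letter contains every letter -/
theorem leaf_full {A : Type*} [Fintype A] (φ : A → List A)
    (hstar : ∀ (a : A) (n : ℕ), 1 ≤ n → alph ((extM φ)^[n] [a]) = alph (φ a))
    (A' : Set A) (hA' : IsLeaf φ A') (b : A) (hb : b ∈ A') (hbu : ¬ BddLetter φ b) :
    alph (φ b) = A' := by
  have hsub : ∀ c ∈ A', alph (φ c) ⊆ A' := by
    intro c hc x hx
    rw [← hA'.1.2.1]
    exact Set.mem_biUnion hc hx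
  have hsub2 : ∀ c, ∀ d ∈ alph (φ c), alph (φ d) ⊆ alph (φ c) := by
    intro c d hd x hx
    rw [← hstar c 2 (by norm_num)]
    rw [alph, Set.mem_ofPred_eq, it_one]
    have : (extM φ)^[1] [d] <:+: (extM φ)^[1] (φ c) := it_infix φ 1 (mem_infix hd)
    apply this.subset
    have hxd : x ∈ φ d := hx
    simpa [extM] using hxd
  -- choose a minimal alphabet below `alph (φ b)`
  obtain ⟨T, ⟨c, hcb, hcu, rfl⟩, hmin⟩ := Set.Finite.exists_minimal
    (s := {T : Set A | ∃ c ∈ alph (φ b), ¬ BddLetter φ c ∧ T = alph (φ c)})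
    (Set.toFinite _) (by
      obtain ⟨d, hd, hdu⟩ := unb_succ φ hbu
      exact ⟨alph (φ d), d, hd, hdu, rfl⟩)
  obtain ⟨d, hd, hdu⟩ := unb_succ φ hcu
  have hvert : IsVertex φ (alph (φ c)) := by
    refine ⟨⟨d, hd⟩, ?_, d, hd, hdu, ?_⟩
    · apply Set.Subset.antisymm
      · intro x hx
        simp only [alphIm, Set.mem_iUnion] at hx
        obtain ⟨e, he, hx⟩ := hx
        exact hsub2 c e he hx
      · intro x hx
        rw [← hstar c 2 (by norm_num), alph, Set.mem_ofPred_eq, it_one] at hx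
        simp only [alphIm, Set.mem_iUnion]
        simp only [Function.iterate_one, extM, List.mem_flatMap] at hx
        obtain ⟨e, he, hx⟩ := hx
        exact ⟨e, he, hx⟩
    · exact Set.Subset.antisymm (hsub2 c d hd)
        (hmin ⟨d, hsub2 b c hcb hd, hdu, rfl⟩ (hsub2 c d hd))
  have hle := hsub2 b c hcb
  have heq := hA'.2 _ hvert (hle.trans (hsub b hb))
  exact Set.Subset.antisymm (hsub b hb) (heq ▸ hle)

end Helpers3

/-- Under Assumption ∗, for a leaf `A'`, an unbounded `g ∈ A'`,
`G' = (A', φ|_{A'}, g)` and a morphism `Ψ`, the set of primitive words `v` with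
`v^k ∈ fact(Ψ(L_{G'}))` for all `k` is finite. -/
theorem stmt12 {A B : Type*} [Fintype A] [Fintype B]
    (φ : A → List A) (Ψ : A → List B) (hφ : NonErasing φ)
    (hstar : ∀ (a : A) (n : ℕ), 1 ≤ n → alph ((extM φ)^[n] [a]) = alph (φ a))
    (A' : Set A) (hA' : IsLeaf φ A')
    (g : A) (hg : g ∈ A') (hgu : ¬ BddLetter φ g) :
    {v : List B | Primitive v ∧ ∀ k : ℕ, wpow v k ∈ factImg Ψ (LangD0L φ [g])}.Finite := by
  classical
  have hfull := leaf_full φ hstar A' hA'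
  have hlang : ∀ n, ∀ a ∈ (extM φ)^[n] [g], a ∈ A' := by
    intro n
    cases n with
    | zero => intro a ha; simp at ha; exact ha ▸ hg
    | succ n =>
      intro a ha
      rw [← hfull g hg hgu, ← hstar g (n+1) (by omega)]
      exact ha
  have himg : ∀ {v : List B} {k : ℕ}, wpow v k ∈ factImg Ψ (LangD0L φ [g]) →
      ∃ n, wpow v k <:+: extM Ψ ((extM φ)^[n] [g]) := by
    rintro v k ⟨u, ⟨n, hn⟩, hu⟩
    exact ⟨n, hu.trans (infix_flatMap Ψ hn)⟩
  obtain ⟨N, hN⟩ := bdd_roots φ Ψ g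
  -- the periodic case
  let P : List B → Prop := fun v => ∀ m, ∃ k, extM Ψ ((extM φ)^[m] [g]) <:+: wpow v k
  have hP : ∃ N', ∀ v, Primitive v → (∀ k, wpow v k ∈ factImg Ψ (LangD0L φ [g])) → P v →
      v.length ≤ N' := by
    by_cases h : ∃ v', P v'
    · obtain ⟨v', hv'⟩ := h
      refine ⟨v'.length, fun v hv hk _ => ?_⟩
      obtain ⟨n, hn⟩ := himg (hk (v'.length + 1))
      obtain ⟨k, hk'⟩ := hv' n
      exact fine_wilf hv le_rfl (hn.trans hk')
    · exact ⟨0, fun v _ _ hPv => absurd ⟨v, hPv⟩ h⟩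
  obtain ⟨N', hN'⟩ := hP
  refine (List.finite_length_le B (max N N')).subset ?_
  rintro v ⟨hv, hk⟩
  show v.length ≤ max N N'
  by_cases hA : ∀ m, ∃ b ∈ A', ¬ BddLetter φ b ∧ ∃ k, extM Ψ ((extM φ)^[m] [b]) <:+: wpow v k
  · refine le_max_of_le_right (hN' v hv hk ?_)
    intro m
    obtain ⟨b, hb, hbu, k, hin⟩ := hA (m + 1)
    refine ⟨k, List.IsInfix.trans (infix_flatMap Ψ ?_) hin⟩
    rw [it_one]
    apply it_infix
    apply mem_infix
    have : g ∈ alph (φ b) := by rw [hfull b hb hbu]; exact hg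
    exact this
  · push Not at hA
    obtain ⟨m, hm⟩ := hA
    refine le_max_of_le_left (hN v hv ?_)
    intro k
    -- lengths of short images
    obtain ⟨K, hK⟩ : ∃ K : ℕ, ∀ n ≤ m, ∀ a, (extM Ψ ((extM φ)^[n] [a])).length < K := by
      refine ⟨(Finset.range (m + 1)).sup
        (fun n => Finset.univ.sup (fun a => (extM Ψ ((extM φ)^[n] [a])).length)) + 1,
        fun n hn a => Nat.lt_succ_of_le ?_⟩
      refine le_trans ?_ (Finset.le_sup (Finset.mem_range.2 (Nat.lt_succ_of_le hn)))
      exact Finset.le_sup (f := fun a => (extM Ψ ((extM φ)^[n] [a])).length) (Finset.mem_univ a)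
    have hKle : ∀ {x : List B} {l : ℕ}, x.length < K → K ≤ l → ¬ wpow v l <:+: x :=
      fun hx hl => pow_not_short hv.1 (lt_of_lt_of_le hx hl)
    obtain ⟨n, hn⟩ := himg (hk ((K + k) + K))
    by_cases hnm : n ≤ m
    · exact absurd hn (hKle (hK n hnm g) (by omega))
    push Not at hnm
    obtain ⟨r, rfl⟩ : ∃ r, n = m + r := ⟨n - m, by omega⟩
    have hf : ∀ y : List A, extM Ψ ((extM φ)^[m] y) =
        y.flatMap (fun a => extM Ψ ((extM φ)^[m] [a])) := by
      intro y
      rw [it_flatMap]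
      simp [extM, List.flatMap_assoc]
    have hone : ∀ d : List A, d.length ≤ 1 →
        (d.flatMap (fun a => extM Ψ ((extM φ)^[m] [a]))).length < K := by
      intro d hd
      rcases d with _ | ⟨a, _ | ⟨b, d⟩⟩
      · have := hK m le_rfl g
        simp only [List.flatMap_nil, List.length_nil]; omega
      · simpa using hK m le_rfl a
      · simp at hd
    rw [Function.iterate_add_apply, hf] at hn
    rcases inf_flatMap (fun a => extM Ψ ((extM φ)^[m] [a])) (fun a => ¬ BddLetter φ a) _ _
      (fun a ha hbad => hm a (hlang r a ha) hbad _) hn with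
      ⟨a, _, hin⟩ | h0 | ⟨d, z, e, hd, he, hz, hin, x, x', hx, hx', heq⟩
    · exact absurd hin (hKle (hK m le_rfl a) (by omega))
    · exact absurd (h0 ▸ List.infix_rfl) (hKle (l := K + k + K) (x := [])
        (by have := hK m le_rfl g; simp only [List.length_nil]; omega) (by omega))
    · have hxl := lt_of_le_of_lt hx.length_le (hone d hd)
      have hxl' := lt_of_le_of_lt hx'.length_le (hone e he)
      refine ⟨(extM φ)^[m] z, m + r, ?_, bdd_it φ (fun a ha => not_not.1 (hz a ha)) m, ?_⟩
      · rw [Function.iterate_add_apply]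
        apply it_infix
        exact List.IsInfix.trans ⟨d, e, rfl⟩ hin
      · rw [hf]
        have h1 : wpow v ((K + k) + K) <:+: (x ++ z.flatMap (fun a => extM Ψ ((extM φ)^[m] [a])))
            ++ x' := heq ▸ List.infix_rfl
        rcases split_pow h1 with h2 | h2
        · rcases split_pow h2 with h3 | h3
          · exact absurd h3 (hKle hxl le_rfl)
          · exact h3
        · exact absurd h2 (hKle hxl' le_rfl)
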